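/- arXiv:1902.04287 — 4 statements merged into one kernel-verified Lean document; each statement's English description precedes it below -/
import Mathlib

section
/- Let M ≥ 3 and let θ¹ < θ² < ⋯ < θᴹ be reals with θᴹ < θ¹ + 2π, θ^{j+1} − θ^j < π for j = 1,…,M−1, and θ¹ + 2π − θᴹ < π; set θ^{M+1} = θ¹ + 2π. Then the convex hull (over ℝ, in ℂ × ℝ regarded as ℝ³) of S({θ¹,…,θᴹ}) equals the polyhedron {(x,r) ∈ ℂ × ℝ : for every j = 1,…,M, cos((θ^j+θ^{j+1})/2)·Re(x) + sin((θ^j+θ^{j+1})/2)·Im(x) ≤ cos((θ^{j+1}−θ^j)/2)·r}. -/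
/-- `S A` is the set of pairs `(x, r)` with `r ≥ 0` and `x = r · exp(𝐢θ)` for some `θ ∈ A`. -/
def polarSet (A : Set ℝ) : Set (ℂ × ℝ) :=
  {p | 0 ≤ p.2 ∧ ∃ θ ∈ A, p.1 = (p.2 : ℂ) * Complex.exp (θ * Complex.I)}

theorem polarSet_smul_mem {A : Set ℝ} {t : ℝ} (ht : 0 ≤ t) {p : ℂ × ℝ} (hp : p ∈ polarSet A) :
    t • p ∈ polarSet A := by
  obtain ⟨h0, θ, hθ, hx⟩ := hp
  refine ⟨mul_nonneg ht h0, θ, hθ, ?_⟩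
  simp only [Prod.smul_fst, Prod.smul_snd, hx, Complex.real_smul, smul_eq_mul, Complex.ofReal_mul]
  ring

open scoped Pointwise in
theorem convexHull_polarSet_smul_mem {A : Set ℝ} {t : ℝ} (ht : 0 ≤ t) {p : ℂ × ℝ}
    (hp : p ∈ convexHull ℝ (polarSet A)) : t • p ∈ convexHull ℝ (polarSet A) := by
  have h : t • p ∈ t • convexHull ℝ (polarSet A) := Set.smul_mem_smul_set hp
  rw [← convexHull_smul] at h
  refine convexHull_mono ?_ h
  rintro _ ⟨q, hq, rfl⟩
  exact polarSet_smul_mem ht hq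

theorem convexHull_polarSet_add_mem {A : Set ℝ} {p q : ℂ × ℝ}
    (hp : p ∈ convexHull ℝ (polarSet A)) (hq : q ∈ convexHull ℝ (polarSet A)) :
    p + q ∈ convexHull ℝ (polarSet A) := by
  have h := convex_convexHull ℝ (polarSet A) (convexHull_polarSet_smul_mem zero_le_two hp)
    (convexHull_polarSet_smul_mem zero_le_two hq)
    (by norm_num : (0 : ℝ) ≤ 1 / 2) (by norm_num : (0 : ℝ) ≤ 1 / 2) (by norm_num)
  simpa [smul_smul] using h

theorem exp_mem_convexHull_polarSet {A : Set ℝ} {α : ℝ} (hα : α ∈ A) :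
    (Complex.exp (α * Complex.I), (1 : ℝ)) ∈ convexHull ℝ (polarSet A) :=
  subset_convexHull ℝ _ ⟨zero_le_one, α, hα, by simp⟩

/-- A vector whose argument lies in `[α, β]`, with `β - α < π`, is a nonnegative combination of the
unit vectors of arguments `α` and `β`. -/
theorem exists_nonneg_combination_exp {α β φ ρ : ℝ} (hαβ : α < β) (hπ : β - α < Real.pi)
    (h₁ : α ≤ φ) (h₂ : φ ≤ β) (hρ : 0 ≤ ρ) :
    ∃ a b : ℝ, 0 ≤ a ∧ 0 ≤ b ∧ (ρ : ℂ) * Complex.exp (φ * Complex.I) =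
      a * Complex.exp (α * Complex.I) + b * Complex.exp (β * Complex.I) := by
  have hs : 0 < Real.sin (β - α) := Real.sin_pos_of_pos_of_lt_pi (by linarith) hπ
  have ha : 0 ≤ Real.sin (β - φ) :=
    Real.sin_nonneg_of_nonneg_of_le_pi (by linarith) (by linarith)
  have hb : 0 ≤ Real.sin (φ - α) :=
    Real.sin_nonneg_of_nonneg_of_le_pi (by linarith) (by linarith)
  refine ⟨ρ * Real.sin (β - φ) / Real.sin (β - α), ρ * Real.sin (φ - α) / Real.sin (β - α),
    by positivity, by positivity, ?_⟩
  apply Complex.ext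
  · simp only [Complex.add_re, Complex.re_ofReal_mul, Complex.exp_ofReal_mul_I_re]
    field_simp
    simp only [Real.sin_sub]
    ring
  · simp only [Complex.add_im, Complex.im_ofReal_mul, Complex.exp_ofReal_mul_I_im]
    field_simp
    simp only [Real.sin_sub]
    ring

theorem exists_le_and_le_succ {θ : ℕ → ℝ} {φ : ℝ} {M : ℕ} (hM : 1 ≤ M) (h₁ : θ 1 ≤ φ)
    (h₂ : φ ≤ θ (M + 1)) : ∃ j, 1 ≤ j ∧ j ≤ M ∧ θ j ≤ φ ∧ φ ≤ θ (j + 1) := by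
  induction M, hM using Nat.le_induction with
  | base => exact ⟨1, le_rfl, le_rfl, h₁, h₂⟩
  | succ n hn ih =>
    rcases le_total φ (θ (n + 1)) with h | h
    · obtain ⟨j, hj, hjn, hj'⟩ := ih h
      exact ⟨j, hj, by omega, hj'⟩
    · exact ⟨n + 1, by omega, le_rfl, h, h₂⟩

theorem exists_consecutive_nonneg_combination_exp {θ : ℕ → ℝ} {M : ℕ} (hM : 1 ≤ M)
    (hstep : ∀ j, 1 ≤ j → j ≤ M → θ j < θ (j + 1))
    (hgap : ∀ j, 1 ≤ j → j ≤ M → θ (j + 1) - θ j < Real.pi)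
    (hM1 : θ (M + 1) = θ 1 + 2 * Real.pi) (x : ℂ) :
    ∃ j, 1 ≤ j ∧ j ≤ M ∧ ∃ a b : ℝ, 0 ≤ a ∧ 0 ≤ b ∧
      x = a * Complex.exp (θ j * Complex.I) + b * Complex.exp (θ (j + 1) * Complex.I) := by
  have hmem := toIcoMod_mem_Ico Real.two_pi_pos (θ 1) x.arg
  set φ := toIcoMod Real.two_pi_pos (θ 1) x.arg with hφ
  have hexp : Complex.exp (φ * Complex.I) = Complex.exp (x.arg * Complex.I) := by
    rw [Complex.exp_eq_exp_iff_exists_int]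
    refine ⟨-toIcoDiv Real.two_pi_pos (θ 1) x.arg, ?_⟩
    rw [hφ, toIcoMod]
    push_cast [zsmul_eq_mul]
    ring
  obtain ⟨j, hj, hjM, h₁, h₂⟩ := exists_le_and_le_succ hM hmem.1 (by linarith [hmem.2])
  refine ⟨j, hj, hjM, ?_⟩
  have h := exists_nonneg_combination_exp (hstep j hj hjM) (hgap j hj hjM) h₁ h₂ (norm_nonneg x)
  rwa [hexp, Complex.norm_mul_exp_arg_mul_I] at h

theorem Real.cos_le_cos_of_le_of_le_two_pi_sub {d t : ℝ} (h0 : 0 ≤ d) (h₁ : d ≤ t)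
    (h₂ : t ≤ 2 * Real.pi - d) : Real.cos t ≤ Real.cos d := by
  rcases le_total t Real.pi with h | h
  · exact Real.cos_le_cos_of_nonneg_of_le_pi h0 h h₁
  · rw [← Real.cos_two_pi_sub t]
    exact Real.cos_le_cos_of_nonneg_of_le_pi h0 (by linarith) (by linarith)


theorem convexHull_polarSet_discrete (M : ℕ) (hM : 3 ≤ M) (θ : ℕ → ℝ)
    (hmono : ∀ j, 1 ≤ j → j < M → θ j < θ (j + 1))
    (hwrap : θ M < θ 1 + 2 * Real.pi)
    (hgap : ∀ j, 1 ≤ j → j < M → θ (j + 1) - θ j < Real.pi)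
    (hgapM : θ 1 + 2 * Real.pi - θ M < Real.pi)
    (hM1 : θ (M + 1) = θ 1 + 2 * Real.pi) :
    convexHull ℝ (polarSet {a : ℝ | ∃ k, 1 ≤ k ∧ k ≤ M ∧ a = θ k}) =
      {p : ℂ × ℝ | ∀ j, 1 ≤ j → j ≤ M →
        Real.cos ((θ j + θ (j + 1)) / 2) * p.1.re +
            Real.sin ((θ j + θ (j + 1)) / 2) * p.1.im ≤
          Real.cos ((θ (j + 1) - θ j) / 2) * p.2} := by
  have hπ := Real.pi_pos
  have hstep : ∀ j, 1 ≤ j → j ≤ M → θ j < θ (j + 1) := by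
    intro j hj hjM
    rcases hjM.lt_or_eq with h | rfl
    · exact hmono j hj h
    · rwa [hM1]
  have hgap' : ∀ j, 1 ≤ j → j ≤ M → θ (j + 1) - θ j < Real.pi := by
    intro j hj hjM
    rcases hjM.lt_or_eq with h | rfl
    · exact hgap j hj h
    · rwa [hM1]
  have hle : ∀ i j, 1 ≤ i → i ≤ j → j ≤ M + 1 → θ i ≤ θ j := by
    intro i j hi hij
    induction j, hij using Nat.le_induction with
    | base => exact fun _ => le_rfl
    | succ n hn ih =>
      exact fun h => (ih (by omega)).trans (hstep n (by omega) (by omega)).le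
  apply Set.Subset.antisymm
  · refine convexHull_min ?_ ?_
    · rintro ⟨x, r⟩ ⟨hr, _, ⟨k, hk, hkM, rfl⟩, hx⟩ j hj hjM
      simp only at hr hx
      subst hx
      simp only [Complex.re_ofReal_mul, Complex.im_ofReal_mul, Complex.exp_ofReal_mul_I_re,
        Complex.exp_ofReal_mul_I_im]
      have hcos : Real.cos ((θ j + θ (j + 1)) / 2 - θ k) ≤ Real.cos ((θ (j + 1) - θ j) / 2) := by
        have hd := hstep j hj hjM
        have h1j := hle 1 j le_rfl hj (by omega)
        have hjM1 := hle (j + 1) (M + 1) (by omega) (by omega) le_rfl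
        have h1k := hle 1 k le_rfl hk (by omega)
        have hkM1 := hle k (M + 1) hk (by omega) le_rfl
        rcases le_or_gt k j with h | h
        · have := hle k j hk h (by omega)
          exact Real.cos_le_cos_of_le_of_le_two_pi_sub (by linarith) (by linarith) (by linarith)
        · have := hle (j + 1) k (by omega) h (by omega)
          rw [← Real.cos_neg]
          exact Real.cos_le_cos_of_le_of_le_two_pi_sub (by linarith) (by linarith) (by linarith)
      rw [Real.cos_sub] at hcos
      linarith [mul_le_mul_of_nonneg_right hcos hr]
    · intro p hp q hq a b ha hb _ j hj hjM
      have h₁ := mul_le_mul_of_nonneg_left (hp j hj hjM) ha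
      have h₂ := mul_le_mul_of_nonneg_left (hq j hj hjM) hb
      simp only [Prod.fst_add, Prod.snd_add, Prod.smul_fst, Prod.smul_snd, Complex.add_re,
        Complex.add_im, Complex.smul_re, Complex.smul_im, smul_eq_mul]
      linarith
  · rintro ⟨x, r⟩ hp
    have hgen : ∀ j, 1 ≤ j → j ≤ M + 1 → (Complex.exp (θ j * Complex.I), (1 : ℝ)) ∈
        convexHull ℝ (polarSet {a : ℝ | ∃ k, 1 ≤ k ∧ k ≤ M ∧ a = θ k}) := by
      intro j hj hjM
      rcases hjM.lt_or_eq with h | rfl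
      · exact exp_mem_convexHull_polarSet ⟨j, hj, by omega, rfl⟩
      · have h := exp_mem_convexHull_polarSet
          (show θ 1 ∈ {a : ℝ | ∃ k, 1 ≤ k ∧ k ≤ M ∧ a = θ k} from ⟨1, le_rfl, by omega, rfl⟩)
        have he : Complex.exp (θ (M + 1) * Complex.I) = Complex.exp (θ 1 * Complex.I) := by
          rw [hM1, Complex.exp_eq_exp_iff_exists_int]
          exact ⟨1, by push_cast; ring⟩
        rwa [he]
    have haxis : ((0 : ℂ), (1 : ℝ)) ∈
        convexHull ℝ (polarSet {a : ℝ | ∃ k, 1 ≤ k ∧ k ≤ M ∧ a = θ k}) := by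
      obtain ⟨j, hj, hjM, a, b, ha, hb, h⟩ := exists_consecutive_nonneg_combination_exp
        (by omega) hstep hgap' hM1 (-Complex.exp (θ 1 * Complex.I))
      have hmem := convexHull_polarSet_smul_mem (by positivity : 0 ≤ (1 + a + b)⁻¹)
        (convexHull_polarSet_add_mem (hgen 1 le_rfl (by omega)) (convexHull_polarSet_add_mem
          (convexHull_polarSet_smul_mem ha (hgen j hj (by omega)))
          (convexHull_polarSet_smul_mem hb (hgen (j + 1) (by omega) (by omega)))))
      convert hmem using 1
      refine Prod.ext ?_ ?_
      · simp only [Prod.smul_fst, Prod.fst_add, Complex.real_smul, ← h]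
        simp
      · simp only [Prod.smul_snd, Prod.snd_add, smul_eq_mul]
        have : 1 + a + b ≠ 0 := by positivity
        field_simp
        ring
    obtain ⟨j, hj, hjM, a, b, ha, hb, h⟩ := exists_consecutive_nonneg_combination_exp
      (by omega) hstep hgap' hM1 x
    have hd : 0 < Real.cos ((θ (j + 1) - θ j) / 2) :=
      Real.cos_pos_of_mem_Ioo
        ⟨by linarith [hstep j hj hjM], by linarith [hgap' j hj hjM]⟩
    have hab : a + b ≤ r := by
      have hc := hp j hj hjM
      have e₁ : Real.cos ((θ (j + 1) - θ j) / 2) =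
          Real.cos ((θ j + θ (j + 1)) / 2) * Real.cos (θ j) +
            Real.sin ((θ j + θ (j + 1)) / 2) * Real.sin (θ j) := by
        rw [← Real.cos_sub]
        ring_nf
      have e₂ : Real.cos ((θ (j + 1) - θ j) / 2) =
          Real.cos ((θ j + θ (j + 1)) / 2) * Real.cos (θ (j + 1)) +
            Real.sin ((θ j + θ (j + 1)) / 2) * Real.sin (θ (j + 1)) := by
        rw [← Real.cos_sub, ← Real.cos_neg]
        ring_nf
      simp only [h, Complex.add_re, Complex.add_im, Complex.re_ofReal_mul, Complex.im_ofReal_mul,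
        Complex.exp_ofReal_mul_I_re, Complex.exp_ofReal_mul_I_im] at hc
      refine le_of_mul_le_mul_left ?_ hd
      linear_combination hc + a * e₁ + b * e₂
    have hmem := convexHull_polarSet_add_mem
      (convexHull_polarSet_add_mem
        (convexHull_polarSet_smul_mem ha (hgen j hj (by omega)))
        (convexHull_polarSet_smul_mem hb (hgen (j + 1) (by omega) (by omega))))
      (convexHull_polarSet_smul_mem (sub_nonneg.2 hab) haxis)
    convert hmem using 1
    refine Prod.ext ?_ ?_
    · simp [h]
    · simp
end

section
/- Let M ≥ 3 and let θ¹ < θ² < ⋯ < θᴹ be reals with θᴹ < θ¹ + 2π, θ^{j+1} − θ^j < π for j = 1,…,M−1, and θ¹ + 2π − θᴹ < π; set θ^{M+1} = θ¹ + 2π. Then for every r ≥ 0 and every k ∈ {1,…,M}, the point x = r·exp(𝐢θᵏ) satisfies, for every j = 1,…,M, the inequality cos((θ^j+θ^{j+1})/2)·Re(x) + sin((θ^j+θ^{j+1})/2)·Im(x) ≤ cos((θ^{j+1}−θ^j)/2)·r. -/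
theorem Real.cos_le_cos_of_mem_Icc_two_pi_sub {h x : ℝ} (h0 : 0 ≤ h) (hx : h ≤ x)
    (hx' : x ≤ 2 * Real.pi - h) : Real.cos x ≤ Real.cos h := by
  have key := Real.cos_sub_cos x h
  have h1 : 0 ≤ Real.sin ((x + h) / 2) :=
    Real.sin_nonneg_of_nonneg_of_le_pi (by linarith) (by linarith)
  have h2 : 0 ≤ Real.sin ((x - h) / 2) :=
    Real.sin_nonneg_of_nonneg_of_le_pi (by linarith) (by linarith)
  linarith [mul_nonneg h1 h2]

theorem discrete_points_satisfy_polyhedron (M : ℕ) (hM : 3 ≤ M) (θ : ℕ → ℝ)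
    (hmono : ∀ j, 1 ≤ j → j < M → θ j < θ (j + 1))
    (hwrap : θ M < θ 1 + 2 * Real.pi)
    (hgap : ∀ j, 1 ≤ j → j < M → θ (j + 1) - θ j < Real.pi)
    (hgapM : θ 1 + 2 * Real.pi - θ M < Real.pi)
    (hM1 : θ (M + 1) = θ 1 + 2 * Real.pi)
    (r : ℝ) (hr : 0 ≤ r) (k : ℕ) (hk1 : 1 ≤ k) (hkM : k ≤ M) :
    ∀ j, 1 ≤ j → j ≤ M →
      Real.cos ((θ j + θ (j + 1)) / 2) * ((r : ℂ) * Complex.exp (θ k * Complex.I)).re +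
          Real.sin ((θ j + θ (j + 1)) / 2) * ((r : ℂ) * Complex.exp (θ k * Complex.I)).im ≤
        Real.cos ((θ (j + 1) - θ j) / 2) * r := by
  have mono : ∀ a b, 1 ≤ a → a ≤ b → b ≤ M + 1 → θ a ≤ θ b := by
    intro a b ha hab
    induction b, hab using Nat.le_induction with
    | base => exact fun _ => le_rfl
    | succ n han ih =>
      intro hn
      refine (ih (by lia)).trans ?_
      rcases (show n ≤ M by lia).lt_or_eq with hnM | rfl
      · exact (hmono n (by lia) hnM).le
      · exact hM1 ▸ hwrap.le
  intro j hj1 hjM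
  have hre : ((r : ℂ) * Complex.exp (θ k * Complex.I)).re = r * Real.cos (θ k) := by
    rw [Complex.re_ofReal_mul, Complex.exp_ofReal_mul_I_re]
  have him : ((r : ℂ) * Complex.exp (θ k * Complex.I)).im = r * Real.sin (θ k) := by
    rw [Complex.im_ofReal_mul, Complex.exp_ofReal_mul_I_im]
  have hcos : Real.cos ((θ j + θ (j + 1)) / 2 - θ k) ≤ Real.cos ((θ (j + 1) - θ j) / 2) := by
    have hstep := mono j (j + 1) hj1 (by lia) (by lia)
    rcases le_or_gt k j with hkj | hjk
    · have h1 := mono k j hk1 hkj (by lia)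
      have h2 := mono (j + 1) (M + 1) (by lia) (by lia) le_rfl
      have h3 := mono 1 k le_rfl hk1 (by lia)
      apply Real.cos_le_cos_of_mem_Icc_two_pi_sub <;> linarith
    · have h1 := mono (j + 1) k (by lia) hjk (by lia)
      have h2 := mono k M hk1 hkM (by lia)
      have h3 := mono 1 j le_rfl hj1 (by lia)
      rw [← Real.cos_neg]
      apply Real.cos_le_cos_of_mem_Icc_two_pi_sub <;> linarith
  rw [hre, him]
  rw [Real.cos_sub] at hcos
  linarith [mul_le_mul_of_nonneg_right hcos hr]
end

section
/- Let ℓ ≤ u be reals. Then the convex hull (over ℝ, in ℝ²) of the parabola segment {(r², r) : r ∈ [ℓ, u]} equals F(ℓ,u) = {(X, r) ∈ ℝ × ℝ : X ≥ r² and X − (ℓ+u)·r + ℓ·u ≤ 0}. -/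
theorem convex_parabola_cap (ℓ u : ℝ) :
    Convex ℝ {p : ℝ × ℝ | p.2 ^ 2 ≤ p.1 ∧ p.1 - (ℓ + u) * p.2 + ℓ * u ≤ 0} := by
  rintro ⟨X, r⟩ ⟨h₁, h₂⟩ ⟨Y, s⟩ ⟨h₃, h₄⟩ a b ha hb hab
  obtain rfl : b = 1 - a := by linarith
  simp only [Set.mem_ofPred_eq, Prod.smul_mk, Prod.mk_add_mk, smul_eq_mul] at *
  constructor
  · nlinarith [mul_nonneg (mul_nonneg ha hb) (sq_nonneg (r - s)),
      mul_le_mul_of_nonneg_left h₁ ha, mul_le_mul_of_nonneg_left h₃ hb]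
  · nlinarith [mul_nonpos_of_nonneg_of_nonpos ha h₂, mul_nonpos_of_nonneg_of_nonpos hb h₄]

theorem convexHull_parabola_segment (ℓ u : ℝ) (hlu : ℓ ≤ u) :
    convexHull ℝ {p : ℝ × ℝ | ∃ r ∈ Set.Icc ℓ u, p = (r ^ 2, r)} =
      {p : ℝ × ℝ | p.2 ^ 2 ≤ p.1 ∧ p.1 - (ℓ + u) * p.2 + ℓ * u ≤ 0} := by
  apply Set.Subset.antisymm
  · refine convexHull_min ?_ (convex_parabola_cap ℓ u)
    rintro _ ⟨r, ⟨hℓ, hu⟩, rfl⟩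
    exact ⟨le_rfl, by nlinarith [mul_nonneg (sub_nonneg.2 hℓ) (sub_nonneg.2 hu)]⟩
  · rintro ⟨X, r⟩ ⟨h₁, h₂⟩
    dsimp only at h₁ h₂
    have hℓ : ℓ ≤ r := by
      by_contra! h
      nlinarith
    rcases hℓ.eq_or_lt with rfl | hlt
    · obtain rfl : X = ℓ ^ 2 := by nlinarith
      exact subset_convexHull ℝ _ ⟨ℓ, ⟨le_rfl, hlu⟩, rfl⟩
    -- `(s ^ 2, s)` is where the line from `(ℓ ^ 2, ℓ)` through `(X, r)` meets the parabola again.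
    obtain ⟨s, hs⟩ : ∃ s, (s + ℓ) * (r - ℓ) = X - ℓ ^ 2 :=
      ⟨(X - ℓ ^ 2) / (r - ℓ) - ℓ, by field_simp [(sub_pos.2 hlt).ne']; ring⟩
    have hrs : r ≤ s := by nlinarith
    have hsu : s ≤ u := by nlinarith
    have hsℓ : 0 < s - ℓ := by linarith
    have key := convex_convexHull ℝ {p : ℝ × ℝ | ∃ r ∈ Set.Icc ℓ u, p = (r ^ 2, r)}
      (subset_convexHull ℝ _ ⟨ℓ, ⟨le_rfl, hlu⟩, rfl⟩)
      (subset_convexHull ℝ _ ⟨s, ⟨by linarith, hsu⟩, rfl⟩)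
      (div_nonneg (sub_nonneg.2 hrs) hsℓ.le) (div_nonneg (sub_nonneg.2 hℓ) hsℓ.le)
      (by field_simp; ring)
    convert key using 1
    obtain rfl : X = (s + ℓ) * (r - ℓ) + ℓ ^ 2 := by linarith
    ext
    · simp only [Prod.smul_mk, Prod.mk_add_mk, smul_eq_mul]
      field_simp
      ring
    · simp only [Prod.smul_mk, Prod.mk_add_mk, smul_eq_mul]
      field_simp
      ring
end

section
/- (Proposition 3, inequality (11)) Let ℓ ≤ u be reals and let (X, r) ∈ ℝ × ℝ satisfy X ≥ r² and X − (ℓ+u)·r + ℓ·u ≤ 0. Then 0 ≤ X − r² ≤ (u − ℓ)²/4. -/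
theorem prop3_ineq11 (ℓ u : ℝ) (hlu : ℓ ≤ u) (X r : ℝ)
    (h1 : r ^ 2 ≤ X) (h2 : X - (ℓ + u) * r + ℓ * u ≤ 0) :
    0 ≤ X - r ^ 2 ∧ X - r ^ 2 ≤ (u - ℓ) ^ 2 / 4 := by
  refine ⟨sub_nonneg.mpr h1, ?_⟩
  nlinarith [sq_nonneg (r - (ℓ + u) / 2)]
end
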